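/- arXiv:2503.19446 — 2 statements merged into one kernel-verified Lean document; each statement's English description precedes it below -/
import Mathlib

section
/- Suppose x(t+1) = A(t)·x(t) + B(t)·u(t) + f(x(t), t) + w(t), z(t+1) = A(t)·z(t) + B(t)·v(t) + d_ref(t), and u(t) = v(t) + K(t)·(x(t) − z(t)). Assume that for each t the map x ↦ f(x, t) is m(t)-Lipschitz in the sup norm, that ‖w(t)‖_∞ ≤ w̄, and that ‖f(x_ref(t), t) − d_ref(t)‖_∞ ≤ ρ(t) for a given reference sequence x_ref : ℕ → ℝ^n. Then the state error e(t) := x(t) − z(t) satisfies, for every t, ‖e(t+1)‖_∞ ≤ (‖A(t) + B(t)·K(t)‖ + m(t))·‖e(t)‖_∞ + m(t)·‖z(t) − x_ref(t)‖_∞ + ρ(t) + w̄, where ‖A(t) + B(t)·K(t)‖ is the operator norm induced by the sup norm. -/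
/-- The operator norm of a matrix acting on `Fin n → ℝ` (sup norm), i.e. the
operator norm induced by the sup norm. -/
noncomputable def supOpNorm {n : ℕ} (M : Matrix (Fin n) (Fin n) ℝ) : ℝ :=
  ‖LinearMap.toContinuousLinearMap M.mulVecLin‖

/-- one-step bound on the state error norm. -/
theorem error_one_step_bound
    (n nu : ℕ)
    (A : ℕ → Matrix (Fin n) (Fin n) ℝ)
    (B : ℕ → Matrix (Fin n) (Fin nu) ℝ)
    (K : ℕ → Matrix (Fin nu) (Fin n) ℝ)
    (x z w dref xref : ℕ → (Fin n → ℝ))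
    (u v : ℕ → (Fin nu → ℝ))
    (f : (Fin n → ℝ) → ℕ → (Fin n → ℝ))
    (m ρ : ℕ → ℝ) (wbar : ℝ)
    (hx : ∀ t, x (t + 1) =
      (A t).mulVec (x t) + (B t).mulVec (u t) + f (x t) t + w t)
    (hz : ∀ t, z (t + 1) =
      (A t).mulVec (z t) + (B t).mulVec (v t) + dref t)
    (hu : ∀ t, u t = v t + (K t).mulVec (x t - z t))
    (hlip : ∀ t, ∀ a b : Fin n → ℝ, ‖f a t - f b t‖ ≤ m t * ‖a - b‖)
    (hw : ∀ t, ‖w t‖ ≤ wbar)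
    (hρ : ∀ t, ‖f (xref t) t - dref t‖ ≤ ρ t) :
    ∀ t, ‖x (t + 1) - z (t + 1)‖ ≤
      (supOpNorm (A t + B t * K t) + m t) * ‖x t - z t‖ +
        m t * ‖z t - xref t‖ + ρ t + wbar := by
  intro t
  have key : x (t + 1) - z (t + 1) = (A t + B t * K t).mulVec (x t - z t)
      + (f (x t) t - f (z t) t) + (f (z t) t - f (xref t) t)
      + (f (xref t) t - dref t) + w t := by
    rw [hx, hz, hu, Matrix.add_mulVec, ← Matrix.mulVec_mulVec, Matrix.mulVec_add,
      Matrix.mulVec_sub (A t)]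
    abel
  have h1 : ‖(A t + B t * K t).mulVec (x t - z t)‖
      ≤ supOpNorm (A t + B t * K t) * ‖x t - z t‖ :=
    (LinearMap.toContinuousLinearMap (A t + B t * K t).mulVecLin).le_opNorm (x t - z t)
  rw [key]
  refine (norm_add_le _ _).trans ?_
  have h2 := norm_add₃_le (a := (A t + B t * K t).mulVec (x t - z t))
    (b := f (x t) t - f (z t) t) (c := f (z t) t - f (xref t) t)
  have h3 := norm_add_le ((A t + B t * K t).mulVec (x t - z t)
      + (f (x t) t - f (z t) t) + (f (z t) t - f (xref t) t)) (f (xref t) t - dref t)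
  have h4 := hlip t (x t) (z t)
  have h5 := hlip t (z t) (xref t)
  linarith [hw t, hρ t]
end

section
/- Let H_x ∈ ℝ^{n_h×n_x}, H_u ∈ ℝ^{n_h×n_u}, K ∈ ℝ^{n_u×n_x}, h ∈ ℝ^{n_h}, and η ≥ 0. Define ψ ∈ ℝ^{n_h} componentwise by ψ_i = sup over v in the closed unit ball of (ℝ^{n_x}, ‖·‖_∞) of the i-th component of (H_x + H_u·K)·v. Suppose z ∈ ℝ^{n_x} and v ∈ ℝ^{n_u} satisfy the tightened constraint H_x·z + H_u·v ≤ h − η·ψ componentwise. Then for every x ∈ ℝ^{n_x} with ‖x − z‖_∞ ≤ η, setting u = v + K·(x − z), the original constraint H_x·x + H_u·u ≤ h holds componentwise. -/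
/-- constraint tightening with the row-wise support function `ψ`
guarantees satisfaction of the original constraints for all states in the
sup-norm tube of radius `η` under the feedback law `u = v + K·(x − z)`. -/
theorem tightened_constraints_robust
    (nh nx nu : ℕ)
    (Hx : Matrix (Fin nh) (Fin nx) ℝ)
    (Hu : Matrix (Fin nh) (Fin nu) ℝ)
    (K : Matrix (Fin nu) (Fin nx) ℝ)
    (h : Fin nh → ℝ) (η : ℝ) (hη : 0 ≤ η)
    (ψ : Fin nh → ℝ)
    (hψ : ∀ i, ψ i = sSup ((fun v : Fin nx → ℝ => ((Hx + Hu * K).mulVec v) i) ''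
      Metric.closedBall (0 : Fin nx → ℝ) 1))
    (z : Fin nx → ℝ) (v : Fin nu → ℝ)
    (hzv : ∀ i, (Hx.mulVec z + Hu.mulVec v) i ≤ h i - η * ψ i) :
    ∀ x : Fin nx → ℝ, ‖x - z‖ ≤ η →
      ∀ i, (Hx.mulVec x + Hu.mulVec (v + K.mulVec (x - z))) i ≤ h i := by
  intro x hx i
  have hc : Continuous (fun v : Fin nx → ℝ => ((Hx + Hu * K).mulVec v) i) :=
    (continuous_apply i).comp (Continuous.matrix_mulVec continuous_const continuous_id)
  have hb : BddAbove ((fun v : Fin nx → ℝ => ((Hx + Hu * K).mulVec v) i) ''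
      Metric.closedBall (0 : Fin nx → ℝ) 1) :=
    ((isCompact_closedBall _ _).image hc).bddAbove
  have key : ((Hx + Hu * K).mulVec (x - z)) i ≤ η * ψ i := by
    rcases hη.eq_or_lt with h0 | hpos
    · have hz : x - z = 0 := norm_le_zero_iff.mp (by rw [h0]; exact hx)
      rw [hz, ← h0]
      simp
    · have hm : ((Hx + Hu * K).mulVec (η⁻¹ • (x - z))) i ≤ ψ i := by
        rw [hψ i]
        refine le_csSup hb ⟨η⁻¹ • (x - z), ?_, rfl⟩
        rw [mem_closedBall_zero_iff, norm_smul, norm_inv, Real.norm_of_nonneg hη]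
        rw [inv_mul_le_iff₀ hpos]
        simpa using hx
      rw [Matrix.mulVec_smul, Pi.smul_apply, smul_eq_mul, inv_mul_le_iff₀ hpos] at hm
      exact hm
  have e : Hx.mulVec x + Hu.mulVec (v + K.mulVec (x - z))
      = (Hx.mulVec z + Hu.mulVec v) + (Hx + Hu * K).mulVec (x - z) := by
    rw [Matrix.add_mulVec, ← Matrix.mulVec_mulVec, Matrix.mulVec_add, Matrix.mulVec_sub Hx]
    abel
  rw [e, Pi.add_apply]
  linarith [hzv i]
end
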